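/- Let c_ρ(u₁,u₂) = (1−ρ²)^{−1/2} exp(½ q^T (I − Σ^{−1}) q) be the density of the bivariate Gauss copula with correlation ρ ∈ (−1,0)∪(0,1), where q = (Φ^{−1}(u₁), Φ^{−1}(u₂)) and Σ is the 2×2 correlation matrix with off-diagonal ρ. Then there exist constants M, k > 0 (depending on ρ) such that sup{c_ρ(u) : u ∈ [ε,1−ε]²} = O(ε^{−k}) as ε → 0; in particular ∫₀^{1/2} √(log sup_{[ε²,1−ε²]²} c_ρ) dε < ∞. -/

import Mathlib

open Set

/-- Standard normal density. -/
noncomputable def stdGaussPdf (s : ℝ) : ℝ :=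
  (Real.sqrt (2 * Real.pi))⁻¹ * Real.exp (-s ^ 2 / 2)

/-- Standard normal cumulative distribution function. -/
noncomputable def stdGaussCdf (t : ℝ) : ℝ := ∫ s in Set.Iic t, stdGaussPdf s

/-- Standard normal quantile function. -/
noncomputable def stdGaussQuantile (y : ℝ) : ℝ := sInf {t | y ≤ stdGaussCdf t}

/-- Density of the bivariate Gauss copula with correlation ρ:
`c_ρ(u) = (1−ρ²)^{−1/2} exp(½ qᵀ(I−Σ⁻¹)q)` with `q = (Φ⁻¹(u₁), Φ⁻¹(u₂))` and
`qᵀ(I−Σ⁻¹)q = (1−ρ²)⁻¹(−ρ²(q₁²+q₂²) + 2ρq₁q₂)`. -/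
noncomputable def gaussCopDensity (ρ u₁ u₂ : ℝ) : ℝ :=
  (Real.sqrt (1 - ρ ^ 2))⁻¹ * Real.exp ((2 * (1 - ρ ^ 2))⁻¹ *
    (-ρ ^ 2 * ((stdGaussQuantile u₁) ^ 2 + (stdGaussQuantile u₂) ^ 2)
      + 2 * ρ * stdGaussQuantile u₁ * stdGaussQuantile u₂))

/-- `K(ε) = sup {c_ρ(u) : u ∈ [ε, 1−ε]²}`. -/
noncomputable def gaussK (ρ ε : ℝ) : ℝ :=
  sSup ((fun p : ℝ × ℝ => gaussCopDensity ρ p.1 p.2) ''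
    (Set.Icc ε (1 - ε) ×ˢ Set.Icc ε (1 - ε)))

open MeasureTheory ProbabilityTheory in
lemma stdGaussCdf_eq (t : ℝ) : stdGaussCdf t = (gaussianReal 0 1).real (Set.Iic t) := by
  have h : ∀ s, stdGaussPdf s = gaussianPDFReal 0 1 s := by
    intro s; simp [stdGaussPdf, gaussianPDFReal]
  rw [Measure.real, gaussianReal_apply_eq_integral 0 one_ne_zero, ENNReal.toReal_ofReal]
  · simp only [stdGaussCdf, h]
  · exact integral_nonneg (fun x => gaussianPDFReal_nonneg _ _ _)

open MeasureTheory ProbabilityTheory in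
lemma cdf_le (t : ℝ) (ht : t ≤ 0) : stdGaussCdf t ≤ Real.exp (-t ^ 2 / 2) := by
  rw [stdGaussCdf_eq]
  have := measure_le_le_exp_mul_mgf (μ := gaussianReal 0 1) (X := id) (t := t) t ht
    (integrable_exp_mul_gaussianReal t)
  rw [mgf_id_gaussianReal, ← Real.exp_add] at this
  refine this.trans (le_of_eq ?_)
  congr 1
  push_cast
  ring

open MeasureTheory ProbabilityTheory in
lemma cdf_ge (t : ℝ) (ht : 0 ≤ t) : 1 - Real.exp (-t ^ 2 / 2) ≤ stdGaussCdf t := by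
  rw [stdGaussCdf_eq]
  have := measure_ge_le_exp_mul_mgf (μ := gaussianReal 0 1) (X := id) (t := t) t ht
    (integrable_exp_mul_gaussianReal t)
  rw [mgf_id_gaussianReal, ← Real.exp_add] at this
  have h2 : (gaussianReal 0 1).real (Set.Iic t)ᶜ ≤ (gaussianReal 0 1).real {ω | t ≤ id ω} := by
    refine measureReal_mono ?_ (measure_ne_top _ _)
    intro x hx
    simp at hx
    exact hx.le
  rw [probReal_compl_eq_one_sub measurableSet_Iic] at h2
  have h3 : -t * t + (0 * t + ((1 : NNReal) : ℝ) * t ^ 2 / 2) = -t ^ 2 / 2 := by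
    push_cast; ring
  rw [h3] at this
  linarith

lemma quantile_sq_le (ε u : ℝ) (hε : 0 < ε) (hu : u ∈ Set.Icc ε (1 - ε)) :
    |stdGaussQuantile u| ≤ Real.sqrt (-2 * Real.log ε) := by
  have hε1 : ε ≤ 1 := by linarith [hu.1, hu.2]
  have hl : Real.log ε ≤ 0 := Real.log_nonpos hε.le hε1
  set T := Real.sqrt (-2 * Real.log ε) with hT
  have hT0 : 0 ≤ T := Real.sqrt_nonneg _
  have hT2 : T ^ 2 = -2 * Real.log ε := Real.sq_sqrt (by linarith)
  have hexp : Real.exp (-T ^ 2 / 2) = ε := by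
    rw [hT2, show -(-2 * Real.log ε) / 2 = Real.log ε by ring, Real.exp_log hε]
  have hmem : T ∈ {t | u ≤ stdGaussCdf t} := by
    have := cdf_ge T hT0
    rw [hexp] at this
    exact hu.2.trans this
  have hlb : ∀ t ∈ {t | u ≤ stdGaussCdf t}, -T ≤ t := by
    intro t ht
    by_contra! hlt
    have h1 := cdf_le t (by linarith)
    have h2 : Real.exp (-t ^ 2 / 2) < ε := by
      rw [← hexp]
      apply Real.exp_lt_exp.2
      nlinarith
    have : u ≤ stdGaussCdf t := ht
    linarith [hu.1]
  rw [abs_le]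
  exact ⟨le_csInf ⟨T, hmem⟩ hlb, csInf_le ⟨-T, hlb⟩ hmem⟩

lemma density_le (ρ : ℝ) (hρ : ρ ∈ Set.Ioo (-1 : ℝ) 1) (ε : ℝ) (hε : 0 < ε) (p : ℝ × ℝ)
    (hp : p ∈ Set.Icc ε (1 - ε) ×ˢ Set.Icc ε (1 - ε)) :
    gaussCopDensity ρ p.1 p.2 ≤
      (Real.sqrt (1 - ρ ^ 2))⁻¹ * ε ^ (-(2 * (1 - ρ ^ 2)⁻¹)) := by
  have h1 := quantile_sq_le ε p.1 hε hp.1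
  have h2 := quantile_sq_le ε p.2 hε hp.2
  have hε1 : ε ≤ 1 := by linarith [hp.1.1, hp.1.2]
  have hl : Real.log ε ≤ 0 := Real.log_nonpos hε.le hε1
  have hd : 0 < 1 - ρ ^ 2 := by nlinarith [hρ.1, hρ.2]
  unfold gaussCopDensity
  refine mul_le_mul_of_nonneg_left ?_ (by positivity)
  rw [Real.rpow_def_of_pos hε]
  apply Real.exp_le_exp.2
  set x := stdGaussQuantile p.1
  set y := stdGaussQuantile p.2
  have hprod : |x| * |y| ≤ -2 * Real.log ε := by
    calc |x| * |y| ≤ Real.sqrt (-2 * Real.log ε) * Real.sqrt (-2 * Real.log ε) := by gcongr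
      _ = _ := Real.mul_self_sqrt (by linarith)
  have hr : |ρ| ≤ 1 := abs_le.2 ⟨hρ.1.le, hρ.2.le⟩
  have h3 : ρ * x * y ≤ -2 * Real.log ε := by
    calc ρ * x * y ≤ |ρ * x * y| := le_abs_self _
      _ = |ρ| * (|x| * |y|) := by rw [abs_mul, abs_mul, mul_assoc]
      _ ≤ 1 * (|x| * |y|) := by gcongr
      _ ≤ _ := by linarith
  have h4 : -ρ ^ 2 * (x ^ 2 + y ^ 2) + 2 * ρ * x * y ≤ -4 * Real.log ε := by
    nlinarith [mul_nonneg (sq_nonneg ρ) (add_nonneg (sq_nonneg x) (sq_nonneg y))]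
  calc _ ≤ (2 * (1 - ρ ^ 2))⁻¹ * (-4 * Real.log ε) :=
        mul_le_mul_of_nonneg_left h4 (by positivity)
    _ = _ := by rw [mul_inv]; ring

lemma bdd_K (ρ : ℝ) (hρ : ρ ∈ Set.Ioo (-1 : ℝ) 1) (ε : ℝ) (hε : 0 < ε) :
    BddAbove ((fun p : ℝ × ℝ => gaussCopDensity ρ p.1 p.2) ''
    (Set.Icc ε (1 - ε) ×ˢ Set.Icc ε (1 - ε))) := by
  refine ⟨(Real.sqrt (1 - ρ ^ 2))⁻¹ * ε ^ (-(2 * (1 - ρ ^ 2)⁻¹)), ?_⟩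
  · rintro _ ⟨p, hp, rfl⟩
    exact density_le ρ hρ ε hε p hp

lemma nonempty_K (ρ ε : ℝ) (hε : ε ≤ 1 / 2) :
    ((fun p : ℝ × ℝ => gaussCopDensity ρ p.1 p.2) ''
    (Set.Icc ε (1 - ε) ×ˢ Set.Icc ε (1 - ε))).Nonempty := by
  have : (1/2 : ℝ) ∈ Set.Icc ε (1 - ε) := ⟨hε, by linarith⟩
  exact ⟨_, (1/2, 1/2), ⟨this, this⟩, rfl⟩

lemma K_le (ρ : ℝ) (hρ : ρ ∈ Set.Ioo (-1 : ℝ) 1) (ε : ℝ) (hε : 0 < ε) (hε2 : ε ≤ 1 / 2) :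
    gaussK ρ ε ≤ (Real.sqrt (1 - ρ ^ 2))⁻¹ * ε ^ (-(2 * (1 - ρ ^ 2)⁻¹)) := by
  apply csSup_le (nonempty_K ρ ε hε2)
  rintro _ ⟨p, hp, rfl⟩
  exact density_le ρ hρ ε hε p hp

lemma K_pos (ρ : ℝ) (hρ : ρ ∈ Set.Ioo (-1 : ℝ) 1) (ε : ℝ) (hε : 0 < ε) (hε2 : ε ≤ 1 / 2) :
    0 < gaussK ρ ε := by
  obtain ⟨c, hc⟩ := nonempty_K ρ ε hε2
  refine lt_of_lt_of_le ?_ (le_csSup (bdd_K ρ hρ ε hε) hc)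
  obtain ⟨p, hp, rfl⟩ := hc
  have hd : 0 < 1 - ρ ^ 2 := by nlinarith [hρ.1, hρ.2]
  have := Real.sqrt_pos.2 hd
  simp only [gaussCopDensity]
  positivity

lemma K_anti (ρ : ℝ) (hρ : ρ ∈ Set.Ioo (-1 : ℝ) 1) (a b : ℝ) (ha : 0 < a) (hab : a ≤ b)
    (hb : b ≤ 1 / 2) : gaussK ρ b ≤ gaussK ρ a := by
  apply csSup_le_csSup (bdd_K ρ hρ a ha) (nonempty_K ρ b hb)
  apply Set.image_mono
  have : Set.Icc b (1 - b) ⊆ Set.Icc a (1 - a) := Set.Icc_subset_Icc hab (by linarith)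
  exact Set.prod_mono this this

/-- The Gauss copula density is polynomially bounded away from the boundary, and
`∫₀^{1/2} √(log K(ε²)) dε < ∞`. -/
theorem stmt18 (ρ : ℝ) (hρ : ρ ∈ Set.Ioo (-1 : ℝ) 1) (hρ0 : ρ ≠ 0) :
    (∃ k : ℝ, 0 < k ∧ ∃ C₀ : ℝ, 0 < C₀ ∧ ∃ ε₀ ∈ Set.Ioo (0:ℝ) (1/2),
      ∀ ε ∈ Set.Ioo (0:ℝ) ε₀, gaussK ρ ε ≤ C₀ * ε ^ (-k)) ∧
    IntervalIntegrable (fun ε => Real.sqrt (Real.log (gaussK ρ (ε ^ 2))))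
      MeasureTheory.volume 0 (1/2) := by
  have hd : 0 < 1 - ρ ^ 2 := by nlinarith [hρ.1, hρ.2]
  have hs := Real.sqrt_pos.2 hd
  constructor
  · refine ⟨2 * (1 - ρ ^ 2)⁻¹, by positivity, (Real.sqrt (1 - ρ ^ 2))⁻¹, by positivity, 1 / 4,
      ⟨by norm_num, by norm_num⟩, ?_⟩
    intro ε hε
    exact K_le ρ hρ ε hε.1 (by linarith [hε.2])
  · have hsq : ∀ ε ∈ Set.Ioc (0:ℝ) (1/2), 0 < ε ^ 2 ∧ ε ^ 2 ≤ 1 / 2 := by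
      intro ε hε
      exact ⟨pow_pos hε.1 2, by nlinarith [hε.1, hε.2]⟩
    have hg : IntervalIntegrable (fun ε => 1 + |Real.log (Real.sqrt (1 - ρ ^ 2))⁻¹
        + -(2 * (1 - ρ ^ 2)⁻¹) * 2 * Real.log ε|) MeasureTheory.volume 0 (1/2) := by
      refine intervalIntegrable_const.add (IntervalIntegrable.abs ?_)
      exact intervalIntegrable_const.add
        (intervalIntegral.intervalIntegrable_log'.const_mul _)
    refine hg.mono_fun ?_ ?_
    · rw [Set.uIoc_of_le (by norm_num)]
      apply AEMeasurable.aestronglyMeasurable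
      apply aemeasurable_restrict_of_antitoneOn measurableSet_Ioc
      intro a ha b hb hab
      apply Real.sqrt_le_sqrt
      apply Real.log_le_log (K_pos ρ hρ _ (hsq b hb).1 (hsq b hb).2)
      exact K_anti ρ hρ _ _ (hsq a ha).1 (pow_le_pow_left₀ ha.1.le hab 2) (hsq b hb).2
    · rw [Set.uIoc_of_le (by norm_num)]
      filter_upwards [MeasureTheory.ae_restrict_mem measurableSet_Ioc] with ε hε
      have h1 := Real.log_le_log (K_pos ρ hρ _ (hsq ε hε).1 (hsq ε hε).2)
        (K_le ρ hρ _ (hsq ε hε).1 (hsq ε hε).2)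
      rw [Real.log_mul (by positivity) (Real.rpow_pos_of_pos (hsq ε hε).1 _).ne',
        Real.log_rpow (hsq ε hε).1, Real.log_pow] at h1
      rw [Real.norm_of_nonneg (Real.sqrt_nonneg _), Real.norm_of_nonneg (by positivity)]
      have h2 : Real.log (gaussK ρ (ε ^ 2)) ≤ |Real.log (Real.sqrt (1 - ρ ^ 2))⁻¹
        + -(2 * (1 - ρ ^ 2)⁻¹) * 2 * Real.log ε| := by
        refine le_trans (h1.trans (le_of_eq ?_)) (le_abs_self _)
        push_cast
        ring
      apply Real.sqrt_le_iff.2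
      refine ⟨by positivity, h2.trans ?_⟩
      nlinarith [abs_nonneg (Real.log (Real.sqrt (1 - ρ ^ 2))⁻¹
        + -(2 * (1 - ρ ^ 2)⁻¹) * 2 * Real.log ε)]
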